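/- Let a₁ > d and a₂ ≥ 0, b₁ > 0, b₂ ≥ 0 with a₁ ≥ b₁. There is a constant C = C(d,a₁,a₂,b₁,b₂) < ∞, independent of L ≥ 1, such that for all x ∈ ℤ^d, ∑_{y ∈ ℤ^d} [⟨x−y⟩_L^{−a₁}/(log⟨(x−y)/L⟩₁)^{a₂}] · [⟨y⟩_L^{−b₁}/(log⟨y/L⟩₁)^{b₂}] ≤ C · L^{d−a₁} · ⟨x⟩_L^{−b₁}/(log⟨x/L⟩₁)^{b₂}. -/

import Mathlib

open Real

/-- Euclidean norm on `ℤ^d`. -/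
noncomputable def znorm {d : ℕ} (x : Fin d → ℤ) : ℝ :=
  Real.sqrt (∑ i, ((x i : ℝ)) ^ 2)

/-- `⟨x⟩_L = (π/2) · max(|x|, L)`. -/
noncomputable def veeZ {d : ℕ} (x : Fin d → ℤ) (L : ℝ) : ℝ :=
  (Real.pi / 2) * max (znorm x) L

/-- `log⟨x/L⟩₁ = log((π/2) · max(|x|/L, 1))`. -/
noncomputable def logveeZ {d : ℕ} (x : Fin d → ℤ) (L : ℝ) : ℝ :=
  Real.log ((Real.pi / 2) * max (znorm x / L) 1)

lemma znorm_eq {d : ℕ} (x : Fin d → ℤ) :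
    znorm x = ‖(WithLp.toLp 2 (fun i => (x i : ℝ)) : EuclideanSpace ℝ (Fin d))‖ := by
  rw [EuclideanSpace.norm_eq]
  simp [znorm]

lemma znorm_tri {d : ℕ} (x y : Fin d → ℤ) : znorm x ≤ znorm (x - y) + znorm y := by
  rw [znorm_eq, znorm_eq, znorm_eq]
  refine le_trans (le_of_eq ?_) (norm_add_le _ _)
  congr 1
  ext i
  simp

lemma abs_le_znorm {d : ℕ} (x : Fin d → ℤ) (i : Fin d) : |(x i : ℝ)| ≤ znorm x := by
  unfold znorm
  apply Real.abs_le_sqrt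
  exact Finset.single_le_sum (f := fun i => ((x i : ℝ)) ^ 2) (fun j _ => sq_nonneg _)
    (Finset.mem_univ i)

noncomputable def TT {d : ℕ} (x : Fin d → ℤ) (L : ℝ) : ℝ := max (znorm x / L) 1

lemma one_le_TT {d : ℕ} (x : Fin d → ℤ) (L : ℝ) : 1 ≤ TT x L := le_max_right _ _

lemma TT_tri {d : ℕ} (x y : Fin d → ℤ) (L : ℝ) (hL : 1 ≤ L) :
    TT x L ≤ TT (x - y) L + TT y L := by
  unfold TT
  apply max_le
  · calc znorm x / L ≤ (znorm (x - y) + znorm y) / L := by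
          gcongr; exact znorm_tri x y
      _ = znorm (x - y) / L + znorm y / L := add_div _ _ _
      _ ≤ _ := add_le_add (le_max_left _ _) (le_max_left _ _)
  · have h1 := le_max_right (znorm (x - y) / L) 1
    have h2 := le_max_right (znorm y / L) 1
    linarith

noncomputable def ps (c g t : ℝ) : ℝ := t ^ (-c) * (Real.log (Real.pi / 2 * t)) ^ (-g)

lemma ell_pos : 0 < Real.log (Real.pi / 2) := by
  apply Real.log_pos
  have := Real.pi_gt_three
  linarith

lemma log_ge {t : ℝ} (ht : 1 ≤ t) : Real.log (Real.pi / 2) ≤ Real.log (Real.pi / 2 * t) := by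
  have := Real.pi_pos
  apply Real.log_le_log (by positivity)
  exact le_mul_of_one_le_right (by positivity) ht

lemma ps_pos (c g : ℝ) {t : ℝ} (ht : 1 ≤ t) : 0 < ps c g t := by
  have h1 := lt_of_lt_of_le ell_pos (log_ge ht)
  have : 0 < t := by linarith
  unfold ps
  positivity

lemma ps_mul (c g c' g' : ℝ) {t : ℝ} (ht : 1 ≤ t) :
    ps c g t * ps c' g' t = ps (c + c') (g + g') t := by
  have h1 := lt_of_lt_of_le ell_pos (log_ge ht)
  have h0 : 0 < t := by linarith
  unfold ps
  rw [neg_add, neg_add, Real.rpow_add h0, Real.rpow_add h1]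
  ring

lemma ps_almost (c g : ℝ) (hc : 0 ≤ c) (h : 0 < c ∨ 0 ≤ g) :
    ∃ K : ℝ, 0 < K ∧ ∀ s t : ℝ, 1 ≤ s → 1 ≤ t → s ≤ 2 * t → ps c g t ≤ K * ps c g s := by
  have hl := ell_pos
  set l := Real.log (Real.pi / 2) with hldef
  rcases le_or_gt 0 g with hg | hg
  · have hlog2 : 0 < Real.log 2 := Real.log_pos (by norm_num)
    refine ⟨2 ^ c * (1 + Real.log 2 / l) ^ g, by positivity, ?_⟩
    intro s t hs ht hst
    have hs0 : 0 < s := by linarith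
    have ht0 : 0 < t := by linarith
    have hlt : l ≤ _ := log_ge ht
    have hls : l ≤ _ := log_ge hs
    have hpi := Real.pi_pos
    have key : Real.log (Real.pi / 2 * s) ≤ (1 + Real.log 2 / l) * Real.log (Real.pi / 2 * t) := by
      have h1 : Real.log (Real.pi / 2 * s) ≤ Real.log (2 * (Real.pi / 2 * t)) := by
        apply Real.log_le_log (by positivity)
        nlinarith
      rw [Real.log_mul (x := 2) (y := Real.pi / 2 * t) (by norm_num) (by positivity)] at h1
      have h2 : Real.log 2 ≤ Real.log 2 / l * Real.log (Real.pi / 2 * t) := by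
        rw [div_mul_eq_mul_div, le_div_iff₀ hl]
        gcongr
      linarith
    unfold ps
    set A := Real.log (Real.pi / 2 * t)
    set B := Real.log (Real.pi / 2 * s)
    have hA : 0 < A := by linarith
    have hB : 0 < B := by linarith
    have e1 : t ^ (-c) ≤ 2 ^ c * s ^ (-c) := by
      rw [Real.rpow_neg ht0.le, Real.rpow_neg hs0.le, ← div_eq_mul_inv, le_div_iff₀ (by positivity),
        inv_mul_le_iff₀ (by positivity), mul_comm, ← Real.mul_rpow (by norm_num) ht0.le]
      exact Real.rpow_le_rpow hs0.le hst hc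
    have e2 : A ^ (-g) ≤ (1 + Real.log 2 / l) ^ g * B ^ (-g) := by
      rw [Real.rpow_neg hA.le, Real.rpow_neg hB.le, ← div_eq_mul_inv, le_div_iff₀ (by positivity),
        inv_mul_le_iff₀ (by positivity), mul_comm, ← Real.mul_rpow (by positivity) hA.le]
      exact Real.rpow_le_rpow hB.le key hg
    calc t ^ (-c) * A ^ (-g) ≤ (2 ^ c * s ^ (-c)) * ((1 + Real.log 2 / l) ^ g * B ^ (-g)) := by
          gcongr
      _ = _ := by ring
  · have hc' : 0 < c := by
      rcases h with h | h
      · exact h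
      · linarith
    obtain ⟨δ, rfl⟩ : ∃ δ, g = -δ := ⟨-g, by ring⟩
    have hδ : 0 < δ := by linarith
    set ε := c / δ with hε
    have hε0 : 0 < ε := by positivity
    refine ⟨2 ^ c * (1 + 1 / (ε * l)) ^ δ, by positivity, ?_⟩
    intro s t hs ht hst
    have hs0 : 0 < s := by linarith
    have ht0 : 0 < t := by linarith
    have hlt : l ≤ _ := log_ge ht
    have hls : l ≤ _ := log_ge hs
    have hpi := Real.pi_pos
    set u := 2 * t / s with hu
    have hu1 : 1 ≤ u := by rw [hu, le_div_iff₀ hs0]; linarith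
    have hu0 : 0 < u := by linarith
    have key : Real.log (Real.pi / 2 * t) ≤
        (1 + 1 / (ε * l)) * u ^ ε * Real.log (Real.pi / 2 * s) := by
      have h1 : Real.log (Real.pi / 2 * t) ≤ Real.log (Real.pi / 2 * s * u) := by
        apply Real.log_le_log (by positivity)
        have : Real.pi / 2 * s * u = 2 * (Real.pi / 2 * t) := by
          rw [hu]; field_simp
        rw [this]
        have : 0 < Real.pi / 2 * t := by positivity
        linarith
      rw [Real.log_mul (x := Real.pi / 2 * s) (y := u) (by positivity) (by positivity)] at h1
      have h2 : Real.log u ≤ u ^ ε / ε := Real.log_le_rpow_div hu0.le hε0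
      have h3 : u ^ ε / ε ≤ 1 / (ε * l) * u ^ ε * Real.log (Real.pi / 2 * s) := by
        have : u ^ ε / ε = 1 / (ε * l) * u ^ ε * l := by field_simp
        rw [this]
        gcongr
      have h4 : 1 ≤ u ^ ε := Real.one_le_rpow hu1 hε0.le
      have h5 : Real.log (Real.pi / 2 * s) ≤ u ^ ε * Real.log (Real.pi / 2 * s) :=
        le_mul_of_one_le_left (by linarith) h4
      linarith
    unfold ps
    rw [neg_neg]
    set A := Real.log (Real.pi / 2 * t)
    set B := Real.log (Real.pi / 2 * s)
    have hA : 0 < A := by linarith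
    have hB : 0 < B := by linarith
    have e2 : A ^ δ ≤ (1 + 1 / (ε * l)) ^ δ * u ^ c * B ^ δ := by
      have := Real.rpow_le_rpow hA.le key hδ.le
      rw [Real.mul_rpow (by positivity) hB.le, Real.mul_rpow (by positivity) (by positivity),
        ← Real.rpow_mul hu0.le] at this
      have h6 : ε * δ = c := by rw [hε]; field_simp
      rwa [h6] at this
    calc t ^ (-c) * A ^ δ ≤ t ^ (-c) * ((1 + 1 / (ε * l)) ^ δ * u ^ c * B ^ δ) := by
          gcongr
      _ = _ := by
        rw [hu, Real.div_rpow (by positivity) hs0.le, Real.mul_rpow (by norm_num) ht0.le,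
          Real.rpow_neg ht0.le, Real.rpow_neg hs0.le]
        field_simp

lemma tele (p t : ℝ) (hp : 0 < p) (ht : 1 ≤ t) :
    t ^ (-(p + 1)) ≤ 2 ^ (p + 1) / p * (t ^ (-p) - (t + 1) ^ (-p)) := by
  have ht0 : 0 < t := by linarith
  set u := t + 1 with hu
  have hu0 : 0 < u := by linarith
  have h1 : u ^ (-p) * (1 + p / u) ≤ t ^ (-p) := by
    have e : t ^ (-p) = u ^ (-p) * (t / u) ^ (-p) := by
      rw [← Real.mul_rpow hu0.le (by positivity)]
      congr 1
      field_simp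
    rw [e]
    gcongr
    rw [Real.rpow_def_of_pos (by positivity)]
    have h2 := Real.log_le_sub_one_of_pos (show 0 < t / u by positivity)
    have h3 : t / u - 1 = - (1 / u) := by rw [hu]; field_simp; ring
    have h4 := Real.add_one_le_exp (Real.log (t / u) * -p)
    have h5 : p / u = p * (1 / u) := by ring
    rw [h5]
    nlinarith
  have h6 : u ^ (-(p + 1)) = u ^ (-p) / u := by
    rw [neg_add, Real.rpow_add hu0, Real.rpow_neg_one]; rfl
  have h7 : p * u ^ (-(p + 1)) ≤ t ^ (-p) - u ^ (-p) := by
    rw [h6]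
    have : u ^ (-p) * (1 + p / u) = u ^ (-p) + p * (u ^ (-p) / u) := by ring
    linarith
  have h8 : t ^ (-(p + 1)) ≤ 2 ^ (p + 1) * u ^ (-(p + 1)) := by
    rw [Real.rpow_neg ht0.le, Real.rpow_neg hu0.le, ← div_eq_mul_inv, le_div_iff₀ (by positivity),
      inv_mul_le_iff₀ (by positivity), mul_comm, ← Real.mul_rpow (by norm_num) ht0.le]
    exact Real.rpow_le_rpow hu0.le (by linarith) (by linarith)
  calc t ^ (-(p + 1)) ≤ 2 ^ (p + 1) * u ^ (-(p + 1)) := h8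
    _ = 2 ^ (p + 1) / p * (p * u ^ (-(p + 1))) := by field_simp
    _ ≤ _ := by gcongr

/-- one-dimensional sum over the naturals -/
lemma one_dim_nat (s : ℝ) (hs : 1 < s) : ∃ C : ℝ, 0 < C ∧ ∀ L : ℝ, 1 ≤ L → ∀ N : ℕ,
    ∑ n ∈ Finset.range N, (max ((n : ℝ) / L) 1) ^ (-s) ≤ C * L := by
  obtain ⟨p, rfl⟩ : ∃ p, s = p + 1 := ⟨s - 1, by ring⟩
  have hp : 0 < p := by linarith
  refine ⟨2 ^ (p + 1) * (2 ^ (p + 1) / p), by positivity, ?_⟩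
  intro L hL N
  have hL0 : 0 < L := by linarith
  have h1 : ∀ n : ℕ, (max ((n : ℝ) / L) 1) ^ (-(p + 1)) ≤
      (2 * L) ^ (p + 1) * (2 ^ (p + 1) / p *
        ((L + n) ^ (-p) - (L + (n + 1 : ℕ)) ^ (-p))) := by
    intro n
    have hn : (0 : ℝ) ≤ n := n.cast_nonneg
    have h2 : (L + n) / (2 * L) ≤ max ((n : ℝ) / L) 1 := by
      have a := le_max_left ((n : ℝ) / L) 1
      have b := le_max_right ((n : ℝ) / L) 1
      have : (L + n) / (2 * L) = (1 + n / L) / 2 := by field_simp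
      linarith
    have h3 := Real.rpow_le_rpow_of_nonpos (z := -(p + 1))
      (show 0 < (L + n) / (2 * L) by positivity) h2 (by linarith)
    refine h3.trans ?_
    have h4 := tele p (L + n) hp (by linarith)
    rw [Real.div_rpow (by positivity) (by positivity), Real.rpow_neg (x := 2 * L) (by positivity),
      div_inv_eq_mul, mul_comm]
    push_cast
    rw [← add_assoc]
    gcongr
  calc _ ≤ ∑ n ∈ Finset.range N, (2 * L) ^ (p + 1) * (2 ^ (p + 1) / p *
        ((L + n) ^ (-p) - (L + (n + 1 : ℕ)) ^ (-p))) := Finset.sum_le_sum fun n _ => h1 n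
    _ = (2 * L) ^ (p + 1) * (2 ^ (p + 1) / p * ((L + (0 : ℕ)) ^ (-p) - (L + N) ^ (-p))) := by
        rw [← Finset.mul_sum, ← Finset.mul_sum,
          Finset.sum_range_sub' (fun n : ℕ => (L + n) ^ (-p))]
    _ ≤ (2 * L) ^ (p + 1) * (2 ^ (p + 1) / p * L ^ (-p)) := by
        gcongr
        have : 0 ≤ (L + N) ^ (-p) := by positivity
        simp only [Nat.cast_zero, add_zero]
        linarith
    _ = _ := by
        rw [Real.mul_rpow (by norm_num) hL0.le, Real.rpow_add hL0, Real.rpow_neg hL0.le]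
        simp only [Real.rpow_one]
        field_simp

lemma one_dim (s : ℝ) (hs : 1 < s) : ∃ C : ℝ, 0 < C ∧ ∀ L : ℝ, 1 ≤ L → ∀ S : Finset ℤ,
    ∑ n ∈ S, (max (|(n : ℝ)| / L) 1) ^ (-s) ≤ C * L := by
  obtain ⟨C, hC, h⟩ := one_dim_nat s hs
  refine ⟨C + C, by positivity, ?_⟩
  intro L hL S
  have hL0 : 0 < L := by linarith
  set q : ℕ → ℝ := fun n => (max ((n : ℝ) / L) 1) ^ (-s) with hq
  have q0 : ∀ n, 0 ≤ q n := fun n => by positivity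
  have qs : Summable q := summable_of_sum_range_le q0 (h L hL)
  have qt : ∑' n, q n ≤ C * L := Real.tsum_le_of_sum_range_le q0 (h L hL)
  have qs' : Summable (fun n => q (n + 1)) := (summable_nat_add_iff 1).2 qs
  have qt' : ∑' n, q (n + 1) ≤ ∑' n, q n := by
    have := qs.sum_add_tsum_nat_add 1
    have h0 : 0 ≤ ∑ i ∈ Finset.range 1, q i := Finset.sum_nonneg fun i _ => q0 i
    linarith
  set f : ℤ → ℝ := fun n => (max (|(n : ℝ)| / L) 1) ^ (-s) with hf
  have f1 : ∀ n : ℕ, f n = q n := by intro n; simp [hf, hq]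
  have f2 : ∀ n : ℕ, f (-(n + 1 : ℤ)) = q (n + 1) := by
    intro n
    simp only [hf, hq]
    push_cast
    rw [abs_neg, abs_of_nonneg (by positivity)]
  have hs1 : HasSum (fun n : ℕ => f n) (∑' n, q n) := by simpa only [f1] using qs.hasSum
  have hs2 : HasSum (fun n : ℕ => f (-(n + 1 : ℤ))) (∑' n, q (n + 1)) := by
    simpa only [f2] using qs'.hasSum
  have hsum := HasSum.of_nat_of_neg_add_one hs1 hs2
  have := sum_le_hasSum S (fun i _ => by positivity) hsum
  linarith

lemma multi_dim (d : ℕ) (a : ℝ) (ha : (d : ℝ) < a) : ∃ C : ℝ, 0 < C ∧ ∀ L : ℝ, 1 ≤ L →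
    ∀ S : Finset (Fin d → ℤ), ∑ y ∈ S, TT y L ^ (-a) ≤ C * L ^ (d : ℝ) := by
  obtain ⟨s, hs, hsd⟩ : ∃ s : ℝ, 1 < s ∧ s * d ≤ a := by
    rcases Nat.eq_zero_or_pos d with h | h
    · subst h
      exact ⟨2, by norm_num, by simpa using ha.le⟩
    · have : (0 : ℝ) < d := by exact_mod_cast h
      refine ⟨a / d, by rw [lt_div_iff₀ this]; linarith, le_of_eq (by field_simp)⟩
  obtain ⟨C, hC, h⟩ := one_dim s hs
  refine ⟨C ^ d, by positivity, ?_⟩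
  intro L hL S
  have hL0 : 0 < L := by linarith
  set t : Fin d → Finset ℤ := fun i => S.image (fun y => y i)
  have hsub : S ⊆ Fintype.piFinset t := by
    intro y hy
    rw [Fintype.mem_piFinset]
    intro i
    exact Finset.mem_image_of_mem (fun y : Fin d → ℤ => y i) hy
  have hT0 : ∀ y : Fin d → ℤ, 0 < TT y L := fun y => lt_of_lt_of_le one_pos (one_le_TT y L)
  have pt : ∀ y : Fin d → ℤ, TT y L ^ (-a) ≤ ∏ i, (max (|(y i : ℝ)| / L) 1) ^ (-s) := by
    intro y
    calc TT y L ^ (-a) ≤ TT y L ^ (-s * d) :=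
          Real.rpow_le_rpow_of_exponent_le (one_le_TT y L) (by linarith)
      _ = ∏ i : Fin d, TT y L ^ (-s) := by
          rw [Finset.prod_const, Real.rpow_mul (hT0 y).le]
          simp
      _ ≤ _ := by
          apply Finset.prod_le_prod
          · intro i _
            have := hT0 y
            positivity
          · intro i _
            apply Real.rpow_le_rpow_of_nonpos (by positivity) _ (by linarith)
            unfold TT
            gcongr
            exact abs_le_znorm y i
  calc ∑ y ∈ S, TT y L ^ (-a)
      ≤ ∑ y ∈ S, ∏ i, (max (|(y i : ℝ)| / L) 1) ^ (-s) := Finset.sum_le_sum fun y _ => pt y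
    _ ≤ ∑ y ∈ Fintype.piFinset t, ∏ i, (max (|(y i : ℝ)| / L) 1) ^ (-s) :=
        Finset.sum_le_sum_of_subset_of_nonneg hsub
          fun y _ _ => Finset.prod_nonneg fun i _ => by positivity
    _ = ∏ i, ∑ n ∈ t i, (max (|(n : ℝ)| / L) 1) ^ (-s) := by
        rw [Finset.prod_univ_sum t (fun _ (n : ℤ) => (max (|(n : ℝ)| / L) 1) ^ (-s))]
    _ ≤ ∏ i : Fin d, (C * L) :=
        Finset.prod_le_prod (fun i _ => Finset.sum_nonneg fun n _ => by positivity)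
          fun i _ => h L hL (t i)
    _ = _ := by
        rw [Finset.prod_const, Real.rpow_natCast, mul_pow]
        simp

lemma ps_sum (d : ℕ) (a g : ℝ) (ha : (d : ℝ) < a) (hg : 0 ≤ g) : ∃ C : ℝ, 0 < C ∧
    ∀ L : ℝ, 1 ≤ L → Summable (fun y : Fin d → ℤ => ps a g (TT y L)) ∧
      ∑' y : Fin d → ℤ, ps a g (TT y L) ≤ C * L ^ (d : ℝ) := by
  obtain ⟨C, hC, h⟩ := multi_dim d a ha
  have hl := ell_pos
  refine ⟨Real.log (Real.pi / 2) ^ (-g) * C, by positivity, ?_⟩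
  intro L hL
  have p0 : ∀ y : Fin d → ℤ, 0 ≤ ps a g (TT y L) := fun y => (ps_pos a g (one_le_TT y L)).le
  have hb : ∀ S : Finset (Fin d → ℤ), ∑ y ∈ S, ps a g (TT y L) ≤
      Real.log (Real.pi / 2) ^ (-g) * C * L ^ (d : ℝ) := by
    intro S
    calc _ ≤ ∑ y ∈ S, Real.log (Real.pi / 2) ^ (-g) * TT y L ^ (-a) := by
          apply Finset.sum_le_sum
          intro y _
          have hy := one_le_TT y L
          unfold ps
          rw [mul_comm]
          gcongr ?_ * _
          exact Real.rpow_le_rpow_of_nonpos hl (log_ge hy) (by linarith)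
      _ ≤ _ := by
          rw [← Finset.mul_sum, mul_assoc]
          gcongr
          exact h L hL S
  exact ⟨summable_of_sum_le p0 hb, Real.tsum_le_of_sum_le p0 hb⟩

lemma term_eq {d : ℕ} (x : Fin d → ℤ) (L a g : ℝ) (hL : 1 ≤ L) :
    veeZ x L ^ (-a) / (logveeZ x L) ^ g = (Real.pi / 2 * L) ^ (-a) * ps a g (TT x L) := by
  have hL0 : 0 < L := by linarith
  have hpi := Real.pi_pos
  have h1 := one_le_TT x L
  have h2 : veeZ x L = Real.pi / 2 * L * TT x L := by
    unfold veeZ TT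
    rw [mul_assoc, mul_max_of_nonneg _ _ hL0.le, mul_div_cancel₀ _ hL0.ne', mul_one]
  have h3 : logveeZ x L = Real.log (Real.pi / 2 * TT x L) := rfl
  have h4 := lt_of_lt_of_le ell_pos (log_ge h1)
  rw [h2, h3, Real.mul_rpow (by positivity) (by linarith)]
  unfold ps
  rw [Real.rpow_neg h4.le g]
  ring

theorem conv_bound_case_a (d : ℕ) (a₁ a₂ b₁ b₂ : ℝ)
    (ha₁ : (d : ℝ) < a₁) (ha₂ : 0 ≤ a₂) (hb₁ : 0 < b₁) (hb₂ : 0 ≤ b₂)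
    (hab : b₁ ≤ a₁) (hab' : a₁ = b₁ → b₂ ≤ a₂) :
    ∃ C : ℝ, 0 < C ∧ ∀ L : ℝ, 1 ≤ L → ∀ x : Fin d → ℤ,
      (∑' y : Fin d → ℤ,
        (veeZ (x - y) L ^ (-a₁) / (logveeZ (x - y) L) ^ a₂) *
        (veeZ y L ^ (-b₁) / (logveeZ y L) ^ b₂))
      ≤ C * L ^ ((d : ℝ) - a₁) * veeZ x L ^ (-b₁) / (logveeZ x L) ^ b₂ := by
  obtain ⟨K, hK, hKb⟩ := ps_almost b₁ b₂ hb₁.le (Or.inl hb₁)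
  obtain ⟨K', hK', hKr⟩ := ps_almost (a₁ - b₁) (a₂ - b₂) (by linarith) (by
    rcases eq_or_lt_of_le hab with h | h
    · right; have := hab' h.symm; linarith
    · left; linarith)
  obtain ⟨C, hC, hS⟩ := ps_sum d a₁ a₂ ha₁ ha₂
  have hpi := Real.pi_pos
  refine ⟨(Real.pi / 2) ^ (-a₁) * ((K + K * K') * (C + C)), by positivity, ?_⟩
  intro L hL x
  have hL0 : 0 < L := by linarith
  obtain ⟨sm, st⟩ := hS L hL
  have sm' : Summable (fun y : Fin d → ℤ => ps a₁ a₂ (TT (x - y) L)) :=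
    (Equiv.subLeft x).summable_iff.2 sm
  have st' : ∑' y : Fin d → ℤ, ps a₁ a₂ (TT (x - y) L) = ∑' y : Fin d → ℤ, ps a₁ a₂ (TT y L) :=
    (Equiv.subLeft x).tsum_eq (fun y : Fin d → ℤ => ps a₁ a₂ (TT y L))
  have pt : ∀ y : Fin d → ℤ, ps a₁ a₂ (TT (x - y) L) * ps b₁ b₂ (TT y L) ≤
      (K + K * K') * ps b₁ b₂ (TT x L) * (ps a₁ a₂ (TT (x - y) L) + ps a₁ a₂ (TT y L)) := by
    intro y
    have tri := TT_tri x y L hL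
    have hr := one_le_TT x L
    have ht := one_le_TT (x - y) L
    have hs := one_le_TT y L
    set r := TT x L
    set t := TT (x - y) L
    set s := TT y L
    have split : ∀ u : ℝ, 1 ≤ u → ps a₁ a₂ u = ps b₁ b₂ u * ps (a₁ - b₁) (a₂ - b₂) u := by
      intro u hu
      rw [ps_mul _ _ _ _ hu]
      congr 1 <;> ring
    have p1 := ps_pos a₁ a₂ ht
    have p2 := ps_pos a₁ a₂ hs
    have p3 := ps_pos b₁ b₂ hr
    have p4 := ps_pos b₁ b₂ ht
    have p5 := ps_pos b₁ b₂ hs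
    have p6 := ps_pos (a₁ - b₁) (a₂ - b₂) ht
    have p7 := ps_pos (a₁ - b₁) (a₂ - b₂) hs
    have expand : (K + K * K') * ps b₁ b₂ r * (ps a₁ a₂ t + ps a₁ a₂ s) =
      K * ps b₁ b₂ r * ps a₁ a₂ t + K * ps b₁ b₂ r * ps a₁ a₂ s +
      K * K' * ps b₁ b₂ r * ps a₁ a₂ t + K * K' * ps b₁ b₂ r * ps a₁ a₂ s := by ring
    have q1 : 0 ≤ K * ps b₁ b₂ r * ps a₁ a₂ t := by positivity
    have q2 : 0 ≤ K * ps b₁ b₂ r * ps a₁ a₂ s := by positivity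
    have q3 : 0 ≤ K * K' * ps b₁ b₂ r * ps a₁ a₂ t := by positivity
    have q4 : 0 ≤ K * K' * ps b₁ b₂ r * ps a₁ a₂ s := by positivity
    rw [expand]
    rcases le_total t s with hts | hst
    · have := hKb r s hr hs (by linarith)
      have : ps a₁ a₂ t * ps b₁ b₂ s ≤ ps a₁ a₂ t * (K * ps b₁ b₂ r) := by gcongr
      linarith
    · have e1 := hKb r t hr ht (by linarith)
      have e2 := hKr s t hs ht (by linarith)
      have : ps a₁ a₂ t * ps b₁ b₂ s ≤ K * K' * ps b₁ b₂ r * ps a₁ a₂ s := by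
        rw [split t ht, split s hs]
        calc _ ≤ (K * ps b₁ b₂ r) * (K' * ps (a₁ - b₁) (a₂ - b₂) s) * ps b₁ b₂ s := by gcongr
          _ = _ := by ring
      linarith
  have smR := (sm'.add sm).mul_left ((K + K * K') * ps b₁ b₂ (TT x L))
  have smL : Summable (fun y : Fin d → ℤ => ps a₁ a₂ (TT (x - y) L) * ps b₁ b₂ (TT y L)) :=
    Summable.of_nonneg_of_le (fun y => (mul_pos (ps_pos _ _ (one_le_TT _ _))
      (ps_pos _ _ (one_le_TT _ _))).le) pt smR
  have main := smL.tsum_le_tsum pt smR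
  rw [tsum_mul_left, sm'.tsum_add sm, st'] at main
  have hx := ps_pos b₁ b₂ (one_le_TT x L)
  rw [mul_div_assoc, term_eq x L b₁ b₂ hL]
  have e : ∀ y : Fin d → ℤ, (veeZ (x - y) L ^ (-a₁) / (logveeZ (x - y) L) ^ a₂) *
        (veeZ y L ^ (-b₁) / (logveeZ y L) ^ b₂) =
      ((Real.pi / 2 * L) ^ (-a₁) * (Real.pi / 2 * L) ^ (-b₁)) *
        (ps a₁ a₂ (TT (x - y) L) * ps b₁ b₂ (TT y L)) := by
    intro y
    rw [term_eq _ L _ _ hL, term_eq _ L _ _ hL]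
    ring
  simp_rw [e]
  rw [tsum_mul_left]
  calc _ ≤ ((Real.pi / 2 * L) ^ (-a₁) * (Real.pi / 2 * L) ^ (-b₁)) *
        ((K + K * K') * ps b₁ b₂ (TT x L) * (C * L ^ (d : ℝ) + C * L ^ (d : ℝ))) := by
        gcongr
        refine main.trans ?_
        gcongr
    _ = _ := by
        rw [Real.mul_rpow (z := -a₁) (by positivity) hL0.le, sub_eq_add_neg, Real.rpow_add hL0]
        ring
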